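/- Let G be a finite simple graph with at least one vertex whose vertex set is partitioned into sets A and B, and let c_A, c_B be positive reals with ŝ(G[A]) ≤ c_A·|A| and ŝ(G[B]) ≤ c_B·|B|. If γ is a real constant satisfying c_A/(c_A + c_B) ≤ γ ≤ |A|/(|A| + |B|), then the sum-color cost satisfies ŝ(G) ≤ ( √(c_A·γ) + √(c_B·(1 − γ)) )²·|V(G)|. -/

import Mathlib

open Finset

/-- Auxiliary fuelled recursion for the slow-coloring game value.
`slowAux G n S` computes the value of the slow-coloring game on the
subgraph of `G` induced by the set `S` of (uncolored) vertices, provided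
`n ≥ S.card`. -/
noncomputable def slowAux {V : Type*} [DecidableEq V] (G : SimpleGraph V) :
    ℕ → Finset V → ℕ
  | 0, _ => 0
  | n + 1, S =>
      (S.powerset.filter fun M => M.Nonempty).sup fun M =>
        M.card + sInf {k : ℕ | ∃ X : Finset V, X ⊆ M ∧ X.Nonempty ∧
          (∀ x ∈ X, ∀ y ∈ X, ¬ G.Adj x y) ∧ k = slowAux G n (S \ X)}

/-- The sum-color cost `ŝ(G[S])` of the subgraph of `G` induced by the
vertex set `S`. -/
noncomputable def slowCost {V : Type*} [DecidableEq V] (G : SimpleGraph V)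
    (S : Finset V) : ℕ :=
  slowAux G S.card S

theorem slowAux_eq_of_card_le {V : Type*} [DecidableEq V] (G : SimpleGraph V) :
    ∀ (m n : ℕ) (S : Finset V), S.card ≤ m → S.card ≤ n → slowAux G m S = slowAux G n S := by
  have hempty : ∀ n, slowAux G n ∅ = 0 := by
    intro n
    cases n with
    | zero => rfl
    | succ n =>
      simp only [slowAux]
      rw [← Nat.le_zero]
      refine Finset.sup_le fun M hM => ?_
      simp only [Finset.mem_filter, Finset.mem_powerset, Finset.subset_empty] at hM
      exact absurd hM.1 hM.2.ne_empty
  intro m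
  induction m with
  | zero =>
    intro n S hm _
    rw [Finset.card_eq_zero.mp (Nat.le_zero.mp hm), hempty, hempty]
  | succ m ih =>
    intro n S hm hn
    cases n with
    | zero => rw [Finset.card_eq_zero.mp (Nat.le_zero.mp hn), hempty, hempty]
    | succ n =>
      simp only [slowAux]
      refine Finset.sup_congr rfl fun M hM => ?_
      have hMS : M ⊆ S := Finset.mem_powerset.mp (Finset.mem_filter.mp hM).1
      have hX : ∀ X : Finset V, X ⊆ M → X.Nonempty →
          slowAux G m (S \ X) = slowAux G n (S \ X) := by
        intro X hXM hne
        have hlt : (S \ X).card < S.card :=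
          Finset.card_lt_card (Finset.sdiff_ssubset (hXM.trans hMS) hne)
        exact ih n _ (by omega) (by omega)
      congr 2
      ext k
      constructor
      · rintro ⟨X, h1, h2, h3, rfl⟩
        exact ⟨X, h1, h2, h3, hX X h1 h2⟩
      · rintro ⟨X, h1, h2, h3, rfl⟩
        exact ⟨X, h1, h2, h3, (hX X h1 h2).symm⟩

theorem slowCost_eq_sup {V : Type*} [DecidableEq V] (G : SimpleGraph V) (S : Finset V) :
    slowCost G S = (S.powerset.filter fun M => M.Nonempty).sup fun M =>
      M.card + sInf {k : ℕ | ∃ X : Finset V, X ⊆ M ∧ X.Nonempty ∧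
        (∀ x ∈ X, ∀ y ∈ X, ¬ G.Adj x y) ∧ k = slowCost G (S \ X)} := by
  have h : slowCost G S = slowAux G (S.card + 1) S :=
    slowAux_eq_of_card_le G _ _ S le_rfl (Nat.le_succ _)
  rw [h]
  simp only [slowAux]
  refine Finset.sup_congr rfl fun M _ => ?_
  have hX : ∀ X : Finset V, slowAux G S.card (S \ X) = slowCost G (S \ X) := fun X =>
    slowAux_eq_of_card_le G _ _ _ (Finset.card_le_card Finset.sdiff_subset) le_rfl
  simp only [hX]

/-- Painter has an optimal answer to every marked set. -/
theorem exists_card_add_slowCost_sdiff_le {V : Type*} [DecidableEq V] (G : SimpleGraph V)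
    {S M : Finset V} (hMS : M ⊆ S) (hM : M.Nonempty) :
    ∃ X ⊆ M, X.Nonempty ∧ (∀ x ∈ X, ∀ y ∈ X, ¬ G.Adj x y) ∧
      M.card + slowCost G (S \ X) ≤ slowCost G S := by
  have hne : {k : ℕ | ∃ X : Finset V, X ⊆ M ∧ X.Nonempty ∧
      (∀ x ∈ X, ∀ y ∈ X, ¬ G.Adj x y) ∧ k = slowCost G (S \ X)}.Nonempty := by
    obtain ⟨v, hv⟩ := hM
    exact ⟨_, {v}, by simpa using hv, by simp, by simp, rfl⟩
  obtain ⟨X, h1, h2, h3, h4⟩ := Nat.sInf_mem hne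
  refine ⟨X, h1, h2, h3, ?_⟩
  rw [← h4, slowCost_eq_sup G S]
  exact Finset.le_sup (f := fun M : Finset V => M.card + sInf {k : ℕ | ∃ X : Finset V, X ⊆ M ∧
      X.Nonempty ∧ (∀ x ∈ X, ∀ y ∈ X, ¬ G.Adj x y) ∧ k = slowCost G (S \ X)})
    (Finset.mem_filter.mpr ⟨Finset.mem_powerset.mpr hMS, hM⟩)

/-- A bound that Painter can maintain after every move of Lister bounds the cost. -/
theorem slowCost_le_of_forall_exists {V : Type*} [DecidableEq V] (G : SimpleGraph V)
    {S : Finset V} {c : ℝ} (hc : 0 ≤ c)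
    (h : ∀ M ⊆ S, M.Nonempty → ∃ X ⊆ M, X.Nonempty ∧ (∀ x ∈ X, ∀ y ∈ X, ¬ G.Adj x y) ∧
      (M.card : ℝ) + slowCost G (S \ X) ≤ c) :
    (slowCost G S : ℝ) ≤ c := by
  rw [← Nat.le_floor_iff hc, slowCost_eq_sup]
  refine Finset.sup_le fun M hM => ?_
  obtain ⟨hMS, hne⟩ := Finset.mem_filter.mp hM
  obtain ⟨X, h1, h2, h3, h4⟩ := h M (Finset.mem_powerset.mp hMS) hne
  rw [Nat.le_floor_iff hc]
  refine le_trans ?_ h4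
  rw [← Nat.cast_add, Nat.cast_le]
  refine Nat.add_le_add_left (Nat.sInf_le ?_) _
  exact ⟨X, h1, h2, h3, rfl⟩

theorem add_sq_sqrt_add_sqrt_le {a a' b x y : ℝ} (ha' : 0 ≤ a')
    (hxa : x + a' ≤ a) (hy : y * √a ≤ x * √b) (hpos : 0 < x) :
    x + y + (√a' + √b) ^ 2 ≤ (√a + √b) ^ 2 := by
  have ha : 0 < a := by linarith
  have hsa : 0 < √a := Real.sqrt_pos.mpr ha
  have h1 := Real.sq_sqrt ha.le
  have h2 := Real.sq_sqrt ha'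
  have h3 := Real.sqrt_nonneg a'
  have h4 := Real.sqrt_nonneg b
  have key : x ≤ 2 * √a * (√a - √a') := by nlinarith [sq_nonneg (√a - √a')]
  have hy' : y ≤ 2 * √b * (√a - √a') := by
    refine le_of_mul_le_mul_right ?_ hsa
    nlinarith [mul_le_mul_of_nonneg_right key h4]
  nlinarith

/-- Painter answers inside `S` and ignores the marks on `T`. -/
theorem exists_answer_of_card_mul_sqrt_le {V : Type*} [DecidableEq V] (G : SimpleGraph V)
    {S T M : Finset V} (hST : Disjoint S T) (hM : M ⊆ S ∪ T) (hMS : (M ∩ S).Nonempty)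
    (hle : ((M ∩ T).card : ℝ) * √(slowCost G S) ≤ (M ∩ S).card * √(slowCost G T))
    (ih : ∀ S' ⊂ S, (slowCost G (S' ∪ T) : ℝ) ≤ (√(slowCost G S') + √(slowCost G T)) ^ 2) :
    ∃ X ⊆ M, X.Nonempty ∧ (∀ x ∈ X, ∀ y ∈ X, ¬ G.Adj x y) ∧
      (M.card : ℝ) + slowCost G ((S ∪ T) \ X) ≤ (√(slowCost G S) + √(slowCost G T)) ^ 2 := by
  obtain ⟨X, h1, h2, h3, h4⟩ :=
    exists_card_add_slowCost_sdiff_le G (Finset.inter_subset_right (s₁ := M) (s₂ := S)) hMS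
  have hXS : X ⊆ S := h1.trans Finset.inter_subset_right
  refine ⟨X, h1.trans Finset.inter_subset_left, h2, h3, ?_⟩
  have hsd : (S ∪ T) \ X = S \ X ∪ T := by
    rw [Finset.union_sdiff_distrib,
      Finset.sdiff_eq_self_of_disjoint (Finset.disjoint_of_subset_left hXS hST).symm]
  have hcard : (M.card : ℝ) = (M ∩ S).card + (M ∩ T).card := by
    have hdisj : Disjoint (M ∩ S) (M ∩ T) :=
      Finset.disjoint_of_subset_left Finset.inter_subset_right
        (Finset.disjoint_of_subset_right Finset.inter_subset_right hST)
    rw [← Nat.cast_add, ← Finset.card_union_of_disjoint hdisj,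
      ← Finset.inter_union_distrib_left, Finset.inter_eq_left.mpr hM]
  rw [hsd, hcard]
  have h5 := ih (S \ X) (Finset.sdiff_ssubset hXS h2)
  have h6 : (((M ∩ S).card : ℕ) : ℝ) + slowCost G (S \ X) ≤ slowCost G S := by exact_mod_cast h4
  have h7 := add_sq_sqrt_add_sqrt_le (Nat.cast_nonneg _)
    h6 hle (by exact_mod_cast Finset.card_pos.mpr hMS)
  linarith

theorem slowCost_union_le {V : Type*} [DecidableEq V] (G : SimpleGraph V) :
    ∀ (n : ℕ) (S T : Finset V), Disjoint S T → S.card + T.card ≤ n →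
      (slowCost G (S ∪ T) : ℝ) ≤ (√(slowCost G S) + √(slowCost G T)) ^ 2 := by
  intro n
  induction n using Nat.strong_induction_on with
  | _ n ih =>
  intro S T hST hn
  refine slowCost_le_of_forall_exists G (sq_nonneg _) fun M hM hne => ?_
  have hS : ∀ S' ⊂ S,
      (slowCost G (S' ∪ T) : ℝ) ≤ (√(slowCost G S') + √(slowCost G T)) ^ 2 := by
    intro S' hS'
    have := Finset.card_lt_card hS'
    exact ih (S'.card + T.card) (by omega) S' T
      (Finset.disjoint_of_subset_left hS'.subset hST) le_rfl
  have hT : ∀ T' ⊂ T,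
      (slowCost G (T' ∪ S) : ℝ) ≤ (√(slowCost G T') + √(slowCost G S)) ^ 2 := by
    intro T' hT'
    have := Finset.card_lt_card hT'
    exact ih (T'.card + S.card) (by omega) T' S
      (Finset.disjoint_of_subset_left hT'.subset hST.symm) le_rfl
  by_cases hcase : (M ∩ S).Nonempty ∧
      ((M ∩ T).card : ℝ) * √(slowCost G S) ≤ (M ∩ S).card * √(slowCost G T)
  · exact exists_answer_of_card_mul_sqrt_le G hST hM hcase.1 hcase.2 hS
  · rw [Finset.union_comm, add_comm (√(slowCost G S : ℝ))]
    rw [Finset.union_comm] at hM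
    have hle : ((M ∩ S).card : ℝ) * √(slowCost G T) ≤ (M ∩ T).card * √(slowCost G S) := by
      by_cases hMS : (M ∩ S).Nonempty
      · exact (not_le.mp fun h => hcase ⟨hMS, h⟩).le
      · rw [Finset.not_nonempty_iff_eq_empty.mp hMS]
        simp only [Finset.card_empty, Nat.cast_zero, zero_mul]
        positivity
    have hMT : (M ∩ T).Nonempty := by
      by_contra h
      have hMT0 := Finset.not_nonempty_iff_eq_empty.mp h
      have hMS : (M ∩ S).Nonempty := by
        rw [← Finset.inter_eq_left.mpr hM, Finset.inter_union_distrib_left, hMT0,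
          Finset.empty_union] at hne
        exact hne
      refine hcase ⟨hMS, ?_⟩
      rw [hMT0]
      simp only [Finset.card_empty, Nat.cast_zero, zero_mul]
      positivity
    exact exists_answer_of_card_mul_sqrt_le G hST.symm hM hMT hle hT

/-- Past its maximum at `p / (p + q)`, the map `t ↦ √(p t) + √(q (1 - t))` decreases. -/
theorem sqrt_mul_add_sqrt_mul_one_sub_le {p q s t : ℝ} (hp : 0 < p) (hq : 0 < q)
    (hs : p / (p + q) ≤ s) (hst : s ≤ t) (ht : t ≤ 1) :
    √(p * t) + √(q * (1 - t)) ≤ √(p * s) + √(q * (1 - s)) := by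
  have hs0 : 0 < s := lt_of_lt_of_le (by positivity) hs
  have hps : p * (1 - s) ≤ q * s := by
    rw [div_le_iff₀ (by positivity)] at hs
    linarith
  have hpt : p * (1 - t) ≤ q * t := by nlinarith
  rw [Real.sqrt_mul hp.le, Real.sqrt_mul hp.le, Real.sqrt_mul hq.le, Real.sqrt_mul hq.le]
  have h1 : √p * √(1 - s) ≤ √q * √s := by
    rw [← Real.sqrt_mul hp.le, ← Real.sqrt_mul hq.le]
    exact Real.sqrt_le_sqrt hps
  have h2 : √p * √(1 - t) ≤ √q * √t := by
    rw [← Real.sqrt_mul hp.le, ← Real.sqrt_mul hq.le]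
    exact Real.sqrt_le_sqrt hpt
  have e1 := Real.sq_sqrt hs0.le
  have e2 := Real.sq_sqrt (hs0.le.trans hst)
  have e3 := Real.sq_sqrt (sub_nonneg.mpr ht)
  have e4 := Real.sq_sqrt (sub_nonneg.mpr (hst.trans ht))
  have l1 : √s ≤ √t := Real.sqrt_le_sqrt hst
  have hsum : 0 < √t + √s := add_pos_of_nonneg_of_pos (Real.sqrt_nonneg _) (Real.sqrt_pos.mpr hs0)
  have l2 : √(1 - t) ≤ √(1 - s) := Real.sqrt_le_sqrt (by linarith)
  have hprod : (√t - √s) * (√t + √s) = (√(1 - s) - √(1 - t)) * (√(1 - s) + √(1 - t)) := by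
    nlinarith
  have key : √p * (√t - √s) ≤ √q * (√(1 - s) - √(1 - t)) := by
    refine le_of_mul_le_mul_right ?_ hsum
    calc √p * (√t - √s) * (√t + √s)
        = (√(1 - s) - √(1 - t)) * (√p * √(1 - s) + √p * √(1 - t)) := by
          rw [mul_assoc, hprod]; ring
      _ ≤ (√(1 - s) - √(1 - t)) * (√q * √s + √q * √t) :=
          mul_le_mul_of_nonneg_left (add_le_add h1 h2) (sub_nonneg.mpr l2)
      _ = √q * (√(1 - s) - √(1 - t)) * (√t + √s) := by ring
  linarith

theorem stmt_8 {V : Type*} [Fintype V] [DecidableEq V] [Nonempty V]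
    (G : SimpleGraph V) (A B : Finset V)
    (hdisj : Disjoint A B) (hcover : ∀ v : V, v ∈ A ∨ v ∈ B)
    (cA cB : ℝ) (hcA : 0 < cA) (hcB : 0 < cB)
    (hA : (slowCost G A : ℝ) ≤ cA * A.card)
    (hB : (slowCost G B : ℝ) ≤ cB * B.card)
    (γ : ℝ) (hγ1 : cA / (cA + cB) ≤ γ)
    (hγ2 : γ ≤ (A.card : ℝ) / ((A.card : ℝ) + (B.card : ℝ))) :
    (slowCost G Finset.univ : ℝ) ≤
      (Real.sqrt (cA * γ) + Real.sqrt (cB * (1 - γ))) ^ 2 * Fintype.card V := by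
  have hunion : A ∪ B = Finset.univ := by
    ext v
    simpa using hcover v
  have hcard : (A.card : ℝ) + B.card = Fintype.card V := by
    rw [← Nat.cast_add, ← Finset.card_union_of_disjoint hdisj, hunion, Finset.card_univ]
  have hn : (0 : ℝ) < Fintype.card V := by exact_mod_cast Fintype.card_pos
  rw [hcard] at hγ2
  set n : ℝ := (Fintype.card V : ℝ)
  set t : ℝ := A.card / n with ht
  have hA' : (A.card : ℝ) = t * n := (div_mul_cancel₀ _ hn.ne').symm
  have hB' : (B.card : ℝ) = (1 - t) * n := by linarith
  have ht1 : t ≤ 1 := by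
    rw [ht, div_le_one hn, ← hcard]
    linarith [Nat.cast_nonneg (α := ℝ) B.card]
  have ht0 : 0 ≤ t := div_nonneg (Nat.cast_nonneg _) hn.le
  have hmain := slowCost_union_le G _ A B hdisj le_rfl
  rw [hunion] at hmain
  have hsA : √(slowCost G A : ℝ) ≤ √(cA * t) * √n := by
    rw [← Real.sqrt_mul (mul_nonneg hcA.le ht0), mul_assoc, ← hA']
    exact Real.sqrt_le_sqrt hA
  have hsB : √(slowCost G B : ℝ) ≤ √(cB * (1 - t)) * √n := by
    rw [← Real.sqrt_mul (mul_nonneg hcB.le (sub_nonneg.mpr ht1)), mul_assoc, ← hB']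
    exact Real.sqrt_le_sqrt hB
  have hmono := sqrt_mul_add_sqrt_mul_one_sub_le hcA hcB hγ1 hγ2 ht1
  calc (slowCost G Finset.univ : ℝ) ≤ (√(slowCost G A) + √(slowCost G B)) ^ 2 := hmain
    _ ≤ ((√(cA * γ) + √(cB * (1 - γ))) * √n) ^ 2 := by
        refine pow_le_pow_left₀ (by positivity) ?_ 2
        nlinarith [mul_le_mul_of_nonneg_right hmono (Real.sqrt_nonneg n)]
    _ = (√(cA * γ) + √(cB * (1 - γ))) ^ 2 * n := by
        rw [mul_pow, Real.sq_sqrt hn.le]
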